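/- arXiv:math/0508049 — 4 statements merged into one kernel-verified Lean document; each statement's English description precedes it below -/
import Mathlib

section
/- Let K > 0 and let ε be a real number with 0 < ε ≤ 1/100. Let (α_n)_{n≥0} and (s_n)_{n≥0} be sequences of non-negative real numbers satisfying the recurrence inequalities α_{n+1} − α_n ≤ ε·(s_n + 2^{-n}·α_n + 2^{-n}·K) and s_{n+1} ≤ (1/2)·s_n + 2^{-n}·α_n + 2^{-(n+1)}·K for all n ≥ 0. If α_0 ≤ ε·K and s_0 ≤ K, then α_n ≤ 10·ε·K for all n. -/
/-- Lemma 5.1 of the paper: the elementary recurrence lemma underlying the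
moduli-space injectivity argument. -/
theorem recurrence_lemma (K ε : ℝ) (hK : 0 < K) (hε : 0 < ε) (hε' : ε ≤ 1 / 100)
    (α s : ℕ → ℝ) (hα : ∀ n, 0 ≤ α n) (hs : ∀ n, 0 ≤ s n)
    (hrec₁ : ∀ n, α (n + 1) - α n ≤ ε * (s n + (1 / 2) ^ n * α n + (1 / 2) ^ n * K))
    (hrec₂ : ∀ n, s (n + 1) ≤ (1 / 2) * s n + (1 / 2) ^ n * α n + (1 / 2) ^ (n + 1) * K)
    (hα₀ : α 0 ≤ ε * K) (hs₀ : s 0 ≤ K) :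
    ∀ n, α n ≤ 10 * ε * K := by
  have key : ∀ n : ℕ, s n ≤ (1 / 2) ^ n * (K * (1 + 6 / 5 * n)) ∧
      α n ≤ ε * K * (38 / 5 - (1 / 2) ^ n * (33 / 5 + 12 / 5 * n)) := by
    intro n
    induction n with
    | zero =>
      norm_num
      exact ⟨hs₀, hα₀⟩
    | succ n ih =>
      obtain ⟨ihs, ihα⟩ := ih
      have h₁ := hrec₁ n
      have h₂ := hrec₂ n
      have hεK : 0 < ε * K := mul_pos hε hK
      have hp : (0 : ℝ) < (1 / 2) ^ n := by positivity
      have hαK : α n ≤ K / 10 := by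
        have : 0 ≤ ε * K * ((1 / 2) ^ n * (33 / 5 + 12 / 5 * n)) := by positivity
        nlinarith
      have hpα : (1 / 2) ^ n * α n ≤ (1 / 2) ^ n * (K / 10) := by gcongr
      have hincr : ε * (s n + (1 / 2) ^ n * α n + (1 / 2) ^ n * K) ≤
          ε * ((1 / 2) ^ n * (K * (1 + 6 / 5 * n)) + (1 / 2) ^ n * (K / 10)
            + (1 / 2) ^ n * K) := by gcongr
      rw [pow_succ] at h₂ ⊢
      push_cast
      constructor <;> linarith
  intro n
  have hεK : 0 < ε * K := mul_pos hε hK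
  have h : 0 ≤ ε * K * ((1 / 2) ^ n * (33 / 5 + 12 / 5 * n)) := by positivity
  linarith [(key n).2]
end

section
/- Let k = 9/10, N > 1 and λ > 0, and set K_N := N/(N − N⁻¹)³. For every point x of EuclideanSpace ℝ (Fin 4) with ‖x‖ ≤ N⁻¹·√λ, the integral over the shell R⁺ = { y : N·√λ < ‖y‖ < k⁻¹·N·√λ } of the function y ↦ ‖x − y‖⁻³ with respect to Lebesgue measure is at most (π²/2)·(k⁻⁴ − 1)·K_N·N³·√λ. -/
open MeasureTheory Real

/-- The volume of the open shell `{y : a < ‖y‖ < b}` in four-dimensional Euclidean space. -/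
theorem volume_real_shell_euclideanSpace_four {a b : ℝ} (ha : 0 ≤ a) (hab : a < b) :
    volume.real {y : EuclideanSpace ℝ (Fin 4) | a < ‖y‖ ∧ ‖y‖ < b} =
      π ^ 2 / 2 * (b ^ 4 - a ^ 4) := by
  have hshell : {y : EuclideanSpace ℝ (Fin 4) | a < ‖y‖ ∧ ‖y‖ < b} =
      Metric.ball 0 b \ Metric.closedBall 0 a := by
    ext y
    simp [and_comm]
  have hball (r : ℝ) (hr : 0 ≤ r) :
      volume.real (Metric.ball (0 : EuclideanSpace ℝ (Fin 4)) r) = π ^ 2 / 2 * r ^ 4 := by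
    rw [measureReal_def, InnerProductSpace.volume_ball_of_dim_even (k := 2) (by simp)]
    simp only [finrank_euclideanSpace, Fintype.card_fin, ENNReal.toReal_mul, ENNReal.toReal_pow,
      ENNReal.toReal_ofReal hr]
    rw [ENNReal.toReal_ofReal (by positivity)]
    norm_num
    ring
  have hclosed : volume.real (Metric.closedBall (0 : EuclideanSpace ℝ (Fin 4)) a) =
      π ^ 2 / 2 * a ^ 4 := by
    rw [measureReal_def, Measure.addHaar_closedBall_eq_addHaar_ball, ← measureReal_def, hball a ha]
  rw [hshell, measureReal_sdiff (Metric.closedBall_subset_ball hab) measurableSet_closedBall,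
    hball b (ha.trans hab.le), hclosed]
  ring

/-- The Green-kernel estimate of Proposition 3.1 (ii): for ‖x‖ ≤ N⁻¹√λ, the integral
of ‖x − y‖⁻³ over the shell R⁺ = {N√λ < ‖y‖ < k⁻¹N√λ} (k = 9/10) is at most
(π²/2)(k⁻⁴ − 1)·K_N·N³·√λ, where K_N = N/(N − N⁻¹)³. -/
theorem green_kernel_shell_integral (k N lam : ℝ) (hk : k = 9 / 10) (hN : 1 < N)
    (hlam : 0 < lam) (K_N : ℝ) (hK_N : K_N = N / (N - N⁻¹) ^ 3)
    (x : EuclideanSpace ℝ (Fin 4)) (hx : ‖x‖ ≤ N⁻¹ * Real.sqrt lam) :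
    ∫ y in {y : EuclideanSpace ℝ (Fin 4) |
        N * Real.sqrt lam < ‖y‖ ∧ ‖y‖ < k⁻¹ * N * Real.sqrt lam},
      (‖x - y‖ ^ 3)⁻¹ ∂volume ≤
    π ^ 2 / 2 * (k⁻¹ ^ 4 - 1) * K_N * N ^ 3 * Real.sqrt lam := by
  have hs : 0 < √lam := Real.sqrt_pos.mpr hlam
  have hN0 : 0 < N := one_pos.trans hN
  have hd : 0 < N - N⁻¹ := sub_pos.mpr ((inv_lt_one_of_one_lt₀ hN).trans hN)
  have hk1 : 1 < k⁻¹ := by rw [hk]; norm_num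
  have hab : N * √lam < k⁻¹ * N * √lam := by
    rw [mul_assoc]
    exact lt_mul_of_one_lt_left (by positivity) hk1
  have hvol := volume_real_shell_euclideanSpace_four (by positivity) hab
  have hvol_pos : 0 < π ^ 2 / 2 * ((k⁻¹ * N * √lam) ^ 4 - (N * √lam) ^ 4) :=
    mul_pos (by positivity) (sub_pos.mpr (by gcongr))
  have hfin : volume {y : EuclideanSpace ℝ (Fin 4) |
      N * √lam < ‖y‖ ∧ ‖y‖ < k⁻¹ * N * √lam} < ⊤ := by
    rw [← hvol, measureReal_def] at hvol_pos
    exact (ENNReal.toReal_pos_iff.mp hvol_pos).2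
  have hbound : ∀ y ∈ {y : EuclideanSpace ℝ (Fin 4) |
      N * √lam < ‖y‖ ∧ ‖y‖ < k⁻¹ * N * √lam},
      ‖(‖x - y‖ ^ 3)⁻¹‖ ≤ (((N - N⁻¹) * √lam) ^ 3)⁻¹ := by
    rintro y ⟨hy, -⟩
    have hdist : (N - N⁻¹) * √lam ≤ ‖x - y‖ := by
      have := norm_sub_norm_le y x
      rw [norm_sub_rev] at this
      linarith
    rw [Real.norm_of_nonneg (by positivity)]
    gcongr
  refine ((le_abs_self _).trans (norm_setIntegral_le_of_norm_le_const hfin hbound)).trans_eq ?_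
  rw [hvol, hK_N]
  have hd' := hd.ne'
  generalize N - N⁻¹ = d at hd'
  field_simp
end

section
/- Let X and Y be real Banach spaces, let D : X → Y be a continuous linear equivalence (an invertible bounded linear operator with bounded inverse), and let B : X → X → Y be a continuous bilinear map. Then there exist ε > 0 and C > 0 such that: for every continuous linear map L : X → Y with operator norm ‖L‖ ≤ ε and every σ ∈ Y with ‖σ‖ ≤ ε, there exists b ∈ X satisfying D b + L b + B b b = −σ and ‖b‖ ≤ C·‖σ‖. -/
theorem norm_bilin_diag_sub_le {X Y : Type*} [NormedAddCommGroup X] [NormedSpace ℝ X]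
    [NormedAddCommGroup Y] [NormedSpace ℝ Y] (B : X →L[ℝ] X →L[ℝ] Y) {r : ℝ} {b c : X}
    (hb : ‖b‖ ≤ r) (hc : ‖c‖ ≤ r) :
    ‖B b b - B c c‖ ≤ 2 * ‖B‖ * r * ‖b - c‖ := by
  have hsplit : B b b - B c c = B (b - c) b + B c (b - c) := by simp
  calc ‖B b b - B c c‖ ≤ ‖B (b - c) b‖ + ‖B c (b - c)‖ := hsplit ▸ norm_add_le _ _
    _ ≤ ‖B‖ * ‖b - c‖ * ‖b‖ + ‖B‖ * ‖c‖ * ‖b - c‖ :=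
      add_le_add (B.le_opNorm₂ _ _) (B.le_opNorm₂ _ _)
    _ ≤ ‖B‖ * ‖b - c‖ * r + ‖B‖ * r * ‖b - c‖ := by gcongr
    _ = 2 * ‖B‖ * r * ‖b - c‖ := by ring


/-- Banach-space solvability lemma underlying equation (3.2) of the paper: if D is an
invertible bounded operator and B a continuous bilinear map, then for L and σ small
one can solve D b + L b + B b b = −σ with the a priori bound ‖b‖ ≤ C‖σ‖. -/
theorem banach_quadratic_solvability
    (X Y : Type*) [NormedAddCommGroup X] [NormedSpace ℝ X] [CompleteSpace X]
    [NormedAddCommGroup Y] [NormedSpace ℝ Y] [CompleteSpace Y]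
    (D : X ≃L[ℝ] Y) (B : X →L[ℝ] X →L[ℝ] Y) :
    ∃ ε > (0 : ℝ), ∃ C > (0 : ℝ),
      ∀ L : X →L[ℝ] Y, ‖L‖ ≤ ε → ∀ σ : Y, ‖σ‖ ≤ ε →
        ∃ b : X, D b + L b + B b b = -σ ∧ ‖b‖ ≤ C * ‖σ‖ := by
  obtain ⟨M, hM1, hDM⟩ : ∃ M : ℝ, 1 ≤ M ∧ ∀ y, ‖D.symm y‖ ≤ M * ‖y‖ := by
    refine ⟨‖(D.symm : Y →L[ℝ] X)‖ + 1, by simp, fun y => ?_⟩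
    exact (D.symm : Y →L[ℝ] X).le_of_opNorm_le (by simp) y
  have hM : 0 < M := by linarith
  set β : ℝ := ‖B‖ + 1 with hβ
  have hβ1 : 1 ≤ β := by linarith [norm_nonneg B]
  have hβ0 : 0 < β := by linarith
  set ε : ℝ := 1 / (16 * M ^ 2 * β) with hε
  have hε_mul : M ^ 2 * β * ε = 1 / 16 := by
    rw [hε]
    field_simp
  have hε0 : 0 < ε := by positivity
  have hMε : M * ε ≤ 1 / 16 := by
    have h1 : M * 1 ≤ M ^ 2 * β := by
      rw [sq]
      exact mul_le_mul (le_mul_of_one_le_left hM.le hM1) hβ1 zero_le_one (by positivity)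
    rw [← hε_mul]
    exact mul_le_mul_of_nonneg_right (by linarith) hε0.le
  refine ⟨ε, hε0, 2 * M, by positivity, fun L hL σ hσ => ?_⟩
  set r : ℝ := 2 * M * ‖σ‖ with hr
  have hr0 : 0 ≤ r := by positivity
  have hBr : M * (2 * ‖B‖ * r) ≤ 1 / 4 := by
    calc M * (2 * ‖B‖ * r) ≤ M * (2 * β * (2 * M * ε)) := by
          rw [hr]
          gcongr
          simp [hβ]
      _ = 4 * (M ^ 2 * β * ε) := by ring
      _ = 1 / 4 := by rw [hε_mul]; norm_num
  let f : X → X := fun b => D.symm (-σ - L b - B b b)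
  have hf_sub : ∀ b c : X, ‖b‖ ≤ r → ‖c‖ ≤ r → ‖f b - f c‖ ≤ 1 / 2 * ‖b - c‖ := by
    intro b c hb hc
    have hsplit : f b - f c = D.symm (-(L (b - c) + (B b b - B c c))) := by
      simp only [f, ← map_sub]
      congr 1
      rw [map_sub]
      abel
    calc ‖f b - f c‖ ≤ M * ‖L (b - c) + (B b b - B c c)‖ := by
          rw [hsplit, ← norm_neg (L (b - c) + _)]
          exact hDM _
      _ ≤ M * (ε * ‖b - c‖ + 2 * ‖B‖ * r * ‖b - c‖) := by
          gcongr
          exact norm_add_le_of_le (L.le_of_opNorm_le hL _) (norm_bilin_diag_sub_le B hb hc)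
      _ = (M * ε + M * (2 * ‖B‖ * r)) * ‖b - c‖ := by ring
      _ ≤ 1 / 2 * ‖b - c‖ := by
          gcongr
          linarith
  have hf_zero : ‖f 0‖ ≤ r / 2 := by
    have h := hDM (-σ)
    rw [norm_neg] at h
    simp only [f, map_zero, sub_zero]
    linarith
  have hmaps : Set.MapsTo f (Metric.closedBall 0 r) (Metric.closedBall 0 r) := by
    intro b hb
    rw [mem_closedBall_zero_iff] at hb ⊢
    have h := hf_sub b 0 hb (by simpa using hr0)
    rw [sub_zero] at h
    have := norm_sub_norm_le (f b) (f 0)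
    linarith
  have hcontr : ContractingWith (1 / 2) (hmaps.restrict f _ _) := by
    refine ⟨by norm_num, LipschitzWith.of_dist_le_mul fun b c => ?_⟩
    have h := hf_sub b c (mem_closedBall_zero_iff.1 b.2) (mem_closedBall_zero_iff.1 c.2)
    simpa [Subtype.dist_eq, dist_eq_norm] using h
  obtain ⟨b, hb, hfix, -⟩ := hcontr.exists_fixedPoint' Metric.isClosed_closedBall.isComplete hmaps
    (Metric.mem_closedBall_self hr0) (edist_ne_top _ _)
  refine ⟨b, ?_, mem_closedBall_zero_iff.1 hb⟩
  have hD : D b = -σ - L b - B b b := D.symm_apply_eq.1 hfix |>.symm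
  rw [hD]
  abel
end

section
/- Let X and Y be real Banach spaces, let D : X → Y be a continuous linear equivalence, and let B : X → X → Y be a continuous bilinear map. Then there exist ε > 0 and C > 0 such that: whenever L, L' : X → Y are continuous linear maps with ‖L‖ ≤ ε and ‖L'‖ ≤ ε, σ, σ' ∈ Y, and b, b' ∈ X satisfy D b + L b + B b b = −σ, D b' + L' b' + B b' b' = −σ', ‖b‖ ≤ ε and ‖b'‖ ≤ ε, one has ‖b − b'‖ ≤ C·( ‖σ − σ'‖ + ‖L − L'‖·‖b'‖ ). -/
/-- Banach-space stability estimate abstracting Proposition 3.2 (i) of the paper: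
solutions of the quadratic equation D b + L b + B b b = −σ depend Lipschitz-ly
on (σ, L), with ‖b − b'‖ ≤ C(‖σ − σ'‖ + ‖L − L'‖·‖b'‖). -/
theorem banach_quadratic_stability
    (X Y : Type*) [NormedAddCommGroup X] [NormedSpace ℝ X] [CompleteSpace X]
    [NormedAddCommGroup Y] [NormedSpace ℝ Y] [CompleteSpace Y]
    (D : X ≃L[ℝ] Y) (B : X →L[ℝ] X →L[ℝ] Y) :
    ∃ ε > (0 : ℝ), ∃ C > (0 : ℝ),
      ∀ L L' : X →L[ℝ] Y, ‖L‖ ≤ ε → ‖L'‖ ≤ ε →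
      ∀ σ σ' : Y, ∀ b b' : X,
        D b + L b + B b b = -σ → D b' + L' b' + B b' b' = -σ' →
        ‖b‖ ≤ ε → ‖b'‖ ≤ ε →
        ‖b - b'‖ ≤ C * (‖σ - σ'‖ + ‖L - L'‖ * ‖b'‖) := by
  set M : ℝ := ‖(D.symm : Y →L[ℝ] X)‖ + 1
  have hMpos : 0 < M := by positivity
  have hKpos : 0 < 1 + 2 * ‖B‖ := by positivity
  refine ⟨1 / (2 * M * (1 + 2 * ‖B‖)), by positivity, 2 * M, by positivity, ?_⟩
  intro L L' hL _ σ σ' b b' h h' hb hb'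
  set ε : ℝ := 1 / (2 * M * (1 + 2 * ‖B‖)) with hε
  have hMε : M * (ε * (1 + 2 * ‖B‖)) = 1 / 2 := by
    rw [hε]; field_simp
  have hD : ‖b - b'‖ ≤ M * ‖D (b - b')‖ := by
    calc ‖b - b'‖ = ‖(D.symm : Y →L[ℝ] X) (D (b - b'))‖ := by simp
      _ ≤ ‖(D.symm : Y →L[ℝ] X)‖ * ‖D (b - b')‖ := ContinuousLinearMap.le_opNorm _ _
      _ ≤ M * ‖D (b - b')‖ := by gcongr; linarith
  have hdiff : D (b - b') =
      -((σ - σ') + L (b - b') + (L - L') b' + B b (b - b') + B (b - b') b') := by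
    have e : D b = -σ - L b - B b b := by rw [← h]; abel
    have e' : D b' = -σ' - L' b' - B b' b' := by rw [← h']; abel
    simp only [map_sub, sub_apply, e, e']
    abel
  have hLw : ‖L (b - b')‖ ≤ ε * ‖b - b'‖ := L.le_of_opNorm_le hL _
  have hLL : ‖(L - L') b'‖ ≤ ‖L - L'‖ * ‖b'‖ := (L - L').le_opNorm _
  have hB₁ : ‖B b (b - b')‖ ≤ ‖B‖ * ε * ‖b - b'‖ :=
    (B.le_opNorm₂ _ _).trans (by gcongr)
  have hB₂ : ‖B (b - b') b'‖ ≤ ‖B‖ * ‖b - b'‖ * ε :=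
    (B.le_opNorm₂ _ _).trans (by gcongr)
  have hbound : ‖D (b - b')‖ ≤
      (‖σ - σ'‖ + ‖L - L'‖ * ‖b'‖) + ε * (1 + 2 * ‖B‖) * ‖b - b'‖ := by
    rw [hdiff, norm_neg]
    refine (norm_add_le_of_le (norm_add₄_le) le_rfl).trans ?_
    linarith
  have hfinal := hD.trans (mul_le_mul_of_nonneg_left hbound hMpos.le)
  have hhalf : M * (ε * (1 + 2 * ‖B‖) * ‖b - b'‖) = 1 / 2 * ‖b - b'‖ := by
    rw [← mul_assoc, hMε]
  rw [mul_add, hhalf] at hfinal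
  linarith
end
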